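/- arXiv:2603.21805 — 5 statements merged into one kernel-verified Lean document; each statement's English description precedes it below -/
import Mathlib

section
/- Let Ω ⊆ ℝ^d (d ≥ 1) be open and nonempty, and let a : ℝ^d → ℝ be measurable, nonnegative a.e. on Ω and locally integrable on Ω. Assume the ball condition: there exist x₀ ∈ ℝ^d, r₀ > 0 and a₀ > 0 such that the closed ball of center x₀ and radius r₀ is contained in Ω, ∫_{B(x₀,r₀)} a(x) dx > 0, and a(x) ≥ a₀ for a.e. x ∈ Ω ∖ B(x₀,r₀). Then there exist b₀ ∈ (0,1] and C > 0 such that for every b ∈ (0, b₀] and every test function u on Ω: ‖∇u‖²_{L²} + b ∫ a|u|² ≥ C b ∫ |u|². -/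
open MeasureTheory Metric

lemma hb_ibp {d : ℕ} (i : Fin d) (c ρ : ℝ) (u : EuclideanSpace ℝ (Fin d) → ℂ)
    (hu : ContDiff ℝ (⊤ : ℕ∞) u) (hc : HasCompactSupport u) :
    Integrable (fun x => Real.cos (ρ * (x i - c)) * ρ * ‖u x‖ ^ 2) ∧
    Integrable (fun x => Real.sin (ρ * (x i - c)) *
      (2 * inner ℝ (u x) (fderiv ℝ u x (EuclideanSpace.single i 1)))) ∧
    ∫ x, Real.sin (ρ * (x i - c)) *
      (2 * inner ℝ (u x) (fderiv ℝ u x (EuclideanSpace.single i 1)))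
      = - ∫ x, Real.cos (ρ * (x i - c)) * ρ * ‖u x‖ ^ 2 := by
  have hcont : Continuous u := hu.continuous
  have hd : Continuous (fderiv ℝ u) := hu.continuous_fderiv (by simp)
  have z : ∀ x, x ∉ tsupport u → u x = 0 := fun x hx => image_eq_zero_of_notMem_tsupport hx
  have h1 : Integrable (fun x : EuclideanSpace ℝ (Fin d) =>
      Real.cos (ρ * (x i - c)) * ρ * ‖u x‖ ^ 2) := by
    apply Continuous.integrable_of_hasCompactSupport (by fun_prop)
    exact HasCompactSupport.intro hc (fun x hx => by simp [z x hx])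
  have h2 : Integrable (fun x => Real.sin (ρ * (x i - c)) *
      (2 * inner ℝ (u x) (fderiv ℝ u x (EuclideanSpace.single i 1)))) := by
    apply Continuous.integrable_of_hasCompactSupport (by fun_prop)
    exact HasCompactSupport.intro hc (fun x hx => by simp [z x hx])
  have h3 : Integrable (fun x : EuclideanSpace ℝ (Fin d) =>
      Real.sin (ρ * (x i - c)) * ‖u x‖ ^ 2) := by
    apply Continuous.integrable_of_hasCompactSupport (by fun_prop)
    exact HasCompactSupport.intro hc (fun x hx => by simp [z x hx])
  refine ⟨h1, h2, ?_⟩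
  refine integral_bilinear_hasLineDerivAt_right_eq_neg_left_of_integrable
    (B := ContinuousLinearMap.mul ℝ ℝ) (v := EuclideanSpace.single i 1)
    (f := fun x : EuclideanSpace ℝ (Fin d) => Real.sin (ρ * (x i - c)))
    (f' := fun x : EuclideanSpace ℝ (Fin d) => Real.cos (ρ * (x i - c)) * ρ)
    (g := fun x => ‖u x‖ ^ 2)
    (g' := fun x => 2 * inner ℝ (u x) (fderiv ℝ u x (EuclideanSpace.single i 1)))
    h1 h2 h3 ?_ ?_
  · intro x _
    have : HasDerivAt (fun t : ℝ => ρ * (x i + t - c)) ρ 0 := by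
      simpa using (((hasDerivAt_id (0:ℝ)).const_add (x i)).sub_const c).const_mul ρ
    have := this.sin
    simpa [HasLineDerivAt] using this
  · intro x _
    have := ((hu.differentiable (by simp)) x).hasFDerivAt.norm_sq.hasLineDerivAt
      (EuclideanSpace.single i 1)
    simpa [mul_add] using this


/-- **Lemma 3.5 (γ = 1): lower bound `‖∇u‖² + b‖a^{1/2}u‖² ≳ b‖u‖²` as `b → 0⁺`
under the ball condition (Assumption 3.1).** -/
theorem lower_bound_hb_ball_condition
    (d : ℕ) (hd : 1 ≤ d)
    (Ω : Set (EuclideanSpace ℝ (Fin d))) (hΩopen : IsOpen Ω) (hΩne : Ω.Nonempty)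
    (a : EuclideanSpace ℝ (Fin d) → ℝ)
    (ha_meas : Measurable a)
    (ha_nonneg : ∀ᵐ x, x ∈ Ω → 0 ≤ a x)
    (ha_loc : LocallyIntegrableOn a Ω)
    (hball : ∃ (x₀ : EuclideanSpace ℝ (Fin d)) (r₀ a₀ : ℝ), 0 < r₀ ∧ 0 < a₀ ∧
      closedBall x₀ r₀ ⊆ Ω ∧
      (0 < ∫ x in ball x₀ r₀, a x) ∧
      (∀ᵐ x, x ∈ Ω \ ball x₀ r₀ → a₀ ≤ a x)) :
    ∃ (b₀ C : ℝ), b₀ ∈ Set.Ioc (0 : ℝ) 1 ∧ 0 < C ∧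
      ∀ b : ℝ, b ∈ Set.Ioc (0 : ℝ) b₀ →
      ∀ u : EuclideanSpace ℝ (Fin d) → ℂ,
        ContDiff ℝ (⊤ : ℕ∞) u → HasCompactSupport u → tsupport u ⊆ Ω →
        C * b * (∫ x, ‖u x‖ ^ 2)
          ≤ (∫ x, ‖fderiv ℝ u x‖ ^ 2) + b * (∫ x, a x * ‖u x‖ ^ 2) := by
  obtain ⟨x₀, r, a₀, hr, ha₀, -, -, hout⟩ := hball
  let i : Fin d := ⟨0, hd⟩
  set ρ := 1 / r with hρ
  have hρ0 : 0 < ρ := by positivity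
  have hcos1 : 0 < Real.cos 1 := Real.cos_one_pos
  set κ := Real.cos 1 * ρ with hκ
  have hκ0 : 0 < κ := by positivity
  set K := (κ + ρ) / a₀ with hK
  have hK0 : 0 < K := by positivity
  set M := 2 / κ + K with hM
  have hM0 : 0 < M := by positivity
  refine ⟨1, κ / 2 / M, by simp, by positivity, ?_⟩
  intro b hb u hu hc hs
  have hcont : Continuous u := hu.continuous
  have hdc : Continuous (fderiv ℝ u) := hu.continuous_fderiv (by simp)
  have z : ∀ x, x ∉ tsupport u → u x = 0 := fun x hx => image_eq_zero_of_notMem_tsupport hx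
  obtain ⟨i1, i2, hibp⟩ := hb_ibp i (x₀ i) ρ u hu hc
  have iu : Integrable (fun x => ‖u x‖ ^ 2) := by
    apply Continuous.integrable_of_hasCompactSupport (by fun_prop)
    exact HasCompactSupport.intro hc (fun x hx => by simp [z x hx])
  have ig : Integrable (fun x => ‖fderiv ℝ u x‖ ^ 2) := by
    apply Continuous.integrable_of_hasCompactSupport (by fun_prop)
    refine HasCompactSupport.intro (hc.fderiv (𝕜 := ℝ)) (fun x hx => ?_)
    simp [image_eq_zero_of_notMem_tsupport hx]
  have ia : Integrable (fun x => a x * ‖u x‖ ^ 2) := by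
    have h := (ha_loc.integrableOn_compact_subset hs hc).mul_continuousOn
      (g' := fun x => ‖u x‖ ^ 2) (by fun_prop) hc
    refine (integrableOn_iff_integrable_of_support_subset ?_).mp h
    intro x hx
    by_contra hx'
    exact hx (by simp [z x hx'])
  have key : ∫ x, κ / 2 * ‖u x‖ ^ 2 ≤
      ∫ x, ((Real.cos (ρ * (x i - x₀ i)) * ρ * ‖u x‖ ^ 2
        + Real.sin (ρ * (x i - x₀ i)) *
          (2 * inner ℝ (u x) (fderiv ℝ u x (EuclideanSpace.single i 1))))
        + (2 / κ * ‖fderiv ℝ u x‖ ^ 2 + K * (a x * ‖u x‖ ^ 2))) := by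
    refine integral_mono_ae (iu.const_mul _)
      ((i1.add i2).add ((ig.const_mul _).add (ia.const_mul _))) ?_
    filter_upwards [ha_nonneg, hout] with x hx1 hx2
    by_cases hxs : x ∈ tsupport u
    swap
    · simp only [z x hxs, norm_zero, inner_zero_left]
      have : 0 ≤ 2 / κ * ‖fderiv ℝ u x‖ ^ 2 := by positivity
      simpa using this
    have hxΩ := hs hxs
    have hin : |inner ℝ (u x) (fderiv ℝ u x (EuclideanSpace.single i 1))|
        ≤ ‖u x‖ * ‖fderiv ℝ u x‖ := by
      refine (abs_real_inner_le_norm _ _).trans ?_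
      gcongr
      simpa using (fderiv ℝ u x).le_opNorm (EuclideanSpace.single i 1)
    have hsin : |Real.sin (ρ * (x i - x₀ i)) *
          (2 * inner ℝ (u x) (fderiv ℝ u x (EuclideanSpace.single i 1)))|
        ≤ 2 * (‖u x‖ * ‖fderiv ℝ u x‖) := by
      rw [abs_mul, abs_mul, abs_two]
      calc _ ≤ 1 * (2 * (‖u x‖ * ‖fderiv ℝ u x‖)) := by
            gcongr
            exact Real.abs_sin_le_one _
        _ = _ := one_mul _
    have hyoung : 2 * (‖u x‖ * ‖fderiv ℝ u x‖)
        ≤ κ / 2 * ‖u x‖ ^ 2 + 2 / κ * ‖fderiv ℝ u x‖ ^ 2 := by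
      have h : 0 ≤ (κ * ‖u x‖ - 2 * ‖fderiv ℝ u x‖) ^ 2 / (2 * κ) := by positivity
      have e : (κ * ‖u x‖ - 2 * ‖fderiv ℝ u x‖) ^ 2 / (2 * κ)
          = κ / 2 * ‖u x‖ ^ 2 + 2 / κ * ‖fderiv ℝ u x‖ ^ 2
            - 2 * (‖u x‖ * ‖fderiv ℝ u x‖) := by
        field_simp
        ring
      linarith
    have hlow := (abs_le.mp hsin).1
    by_cases hxb : x ∈ ball x₀ r
    · have habs : |ρ * (x i - x₀ i)| ≤ 1 := by
        have h1 : |x i - x₀ i| ≤ r := by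
          have := PiLp.norm_apply_le (x - x₀) i
          rw [mem_ball_iff_norm] at hxb
          simp only [PiLp.sub_apply, Real.norm_eq_abs] at this
          linarith
        rw [abs_mul, abs_of_pos hρ0, hρ, one_div, inv_mul_le_iff₀ hr]
        linarith
      have hcos : Real.cos 1 ≤ Real.cos (ρ * (x i - x₀ i)) := by
        rw [← Real.cos_abs (ρ * (x i - x₀ i))]
        exact Real.cos_le_cos_of_nonneg_of_le_pi (abs_nonneg _)
          (by linarith [Real.pi_gt_three]) habs
      have h1 : κ * ‖u x‖ ^ 2 ≤ Real.cos (ρ * (x i - x₀ i)) * ρ * ‖u x‖ ^ 2 := by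
        rw [hκ]; gcongr
      have h2 : 0 ≤ K * (a x * ‖u x‖ ^ 2) := by
        have := hx1 hxΩ
        positivity
      linarith
    · have h1 : -(ρ * ‖u x‖ ^ 2) ≤ Real.cos (ρ * (x i - x₀ i)) * ρ * ‖u x‖ ^ 2 := by
        have := mul_le_mul_of_nonneg_right (Real.neg_one_le_cos (ρ * (x i - x₀ i)))
          (by positivity : 0 ≤ ρ * ‖u x‖ ^ 2)
        linarith
      have h2 : (κ + ρ) * ‖u x‖ ^ 2 ≤ K * (a x * ‖u x‖ ^ 2) := by
        have h3 := hx2 ⟨hxΩ, hxb⟩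
        calc (κ + ρ) * ‖u x‖ ^ 2 = K * (a₀ * ‖u x‖ ^ 2) := by
              rw [hK]; field_simp
          _ ≤ _ := by gcongr
      linarith
  rw [integral_add (by exact i1.add i2) (by exact (ig.const_mul _).add (ia.const_mul _)),
    integral_add i1 i2, integral_add (ig.const_mul _) (ia.const_mul _), hibp,
    integral_const_mul, integral_const_mul, integral_const_mul] at key
  have hG : 0 ≤ ∫ x, ‖fderiv ℝ u x‖ ^ 2 := integral_nonneg (fun x => by positivity)
  have hA : 0 ≤ ∫ x, a x * ‖u x‖ ^ 2 := by
    refine integral_nonneg_of_ae ?_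
    filter_upwards [ha_nonneg] with x hx1
    by_cases hxs : x ∈ tsupport u
    · have := hx1 (hs hxs)
      simp only [Pi.zero_apply]
      positivity
    · simp [z x hxs]
  set T := ∫ x, ‖u x‖ ^ 2
  set G := ∫ x, ‖fderiv ℝ u x‖ ^ 2
  set A := ∫ x, a x * ‖u x‖ ^ 2
  obtain ⟨hb0, hb1⟩ := hb
  have hMk : 0 < 2 / κ := by positivity
  have e : κ / 2 / M * b * T = (b * (κ / 2 * T)) / M := by ring
  rw [e, div_le_iff₀ hM0]
  have k1 : b * (κ / 2 * T) ≤ b * (2 / κ * G + K * A) := by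
    gcongr
    linarith
  have k2 : b * (2 / κ * G) ≤ 1 * (2 / κ * G) := by gcongr
  have k3 : 0 ≤ K * G := by positivity
  have k4 : 0 ≤ 2 / κ * (b * A) := by positivity
  rw [hM]
  linarith
end

section
/- Let Ω ⊆ ℝ^d (d ≥ 1) be open, and let a : ℝ^d → ℝ be measurable, nonnegative a.e. on Ω and locally integrable on Ω. Assume the polynomial growth condition: there exist r₀ > 0, c > 0 and β > 0 such that ℝ^d ∖ B(0,r₀) ⊆ Ω and a(x) ≥ c‖x‖^β for a.e. x with ‖x‖ > r₀. Then there exist b₀ ∈ (0,1] and C > 0 such that for every b ∈ (0, b₀] and every test function u on Ω: ‖∇u‖²_{L²} + b ∫ a|u|² ≥ C b^{2/(2+β)} ∫ |u|². -/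
open MeasureTheory Metric

lemma aux_jensen (f : ℝ → ℝ) (hf : Continuous f) :
    (∫ t in (0:ℝ)..1, f t) ^ 2 ≤ ∫ t in (0:ℝ)..1, f t ^ 2 := by
  set m := ∫ t in (0:ℝ)..1, f t with hm
  have h0 : 0 ≤ ∫ t in (0:ℝ)..1, (f t - m) ^ 2 :=
    intervalIntegral.integral_nonneg (by norm_num) (fun t _ => sq_nonneg _)
  have h1 : (∫ t in (0:ℝ)..1, (f t - m) ^ 2)
      = (∫ t in (0:ℝ)..1, f t ^ 2) - 2 * m * (∫ t in (0:ℝ)..1, f t) + m ^ 2 := by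
    have : ∀ t, (f t - m) ^ 2 = f t ^ 2 - 2 * m * f t + m ^ 2 := fun t => by ring
    simp_rw [this]
    rw [intervalIntegral.integral_add, intervalIntegral.integral_sub,
      intervalIntegral.integral_const_mul]
    · simp
    all_goals exact Continuous.intervalIntegrable (by fun_prop) _ _
  rw [h1, ← hm] at h0
  nlinarith

lemma aux_pointwise {E : Type*} [NormedAddCommGroup E] [NormedSpace ℝ E]
    (u : E → ℂ) (hu : ContDiff ℝ 1 u) (v x : E) :
    ‖u (x + v) - u x‖ ^ 2 ≤ ∫ t in (0:ℝ)..1, ‖v‖ ^ 2 * ‖fderiv ℝ u (x + t • v)‖ ^ 2 := by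
  have hc : Continuous (fderiv ℝ u) := hu.continuous_fderiv (by norm_num)
  have hd : ∀ t : ℝ, HasDerivAt (fun t : ℝ => u (x + t • v)) (fderiv ℝ u (x + t • v) v) t := by
    intro t
    have h1 : HasFDerivAt u (fderiv ℝ u (x + t • v)) (x + t • v) :=
      (hu.differentiable (by norm_num) _).hasFDerivAt
    have h2 : HasDerivAt (fun t : ℝ => x + t • v) v t := by
      simpa using ((hasDerivAt_id t).smul_const v).const_add x
    exact h1.comp_hasDerivAt t h2
  have hcont : Continuous (fun t : ℝ => fderiv ℝ u (x + t • v) v) := by fun_prop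
  have hftc : ∫ t in (0:ℝ)..1, fderiv ℝ u (x + t • v) v = u (x + v) - u x := by
    rw [intervalIntegral.integral_eq_sub_of_hasDerivAt (fun t _ => hd t)
      (hcont.intervalIntegrable _ _)]
    simp
  calc ‖u (x + v) - u x‖ ^ 2
      ≤ (∫ t in (0:ℝ)..1, ‖fderiv ℝ u (x + t • v) v‖) ^ 2 := by
        rw [← hftc]
        gcongr
        exact intervalIntegral.norm_integral_le_integral_norm (by norm_num)
    _ ≤ ∫ t in (0:ℝ)..1, ‖fderiv ℝ u (x + t • v) v‖ ^ 2 := aux_jensen _ hcont.norm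
    _ ≤ _ := by
        apply intervalIntegral.integral_mono_on (by norm_num)
        · exact Continuous.intervalIntegrable (by fun_prop) _ _
        · exact Continuous.intervalIntegrable (by fun_prop) _ _
        · intro t _
          rw [← mul_pow]
          gcongr
          rw [mul_comm]
          exact ContinuousLinearMap.le_opNorm _ _

lemma aux_shift {d : ℕ} (u : EuclideanSpace ℝ (Fin d) → ℂ) (hu : ContDiff ℝ 1 u)
    (hs : HasCompactSupport u) (v : EuclideanSpace ℝ (Fin d)) :
    ∫ x, ‖u (x + v) - u x‖ ^ 2 ≤ ‖v‖ ^ 2 * ∫ x, ‖fderiv ℝ u x‖ ^ 2 := by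
  have hc : Continuous (fderiv ℝ u) := hu.continuous_fderiv (by norm_num)
  have huc := hu.continuous
  have hI : Integrable (fun x => ‖fderiv ℝ u x‖ ^ 2) := by
    apply Continuous.integrable_of_hasCompactSupport (by fun_prop)
    exact (hs.fderiv ℝ).comp_left (g := fun y => ‖y‖ ^ 2) (by simp)
  rw [integral_eq_lintegral_of_nonneg_ae (Filter.Eventually.of_forall fun x => by positivity)
    (Continuous.aestronglyMeasurable (by fun_prop))]
  apply ENNReal.toReal_le_of_le_ofReal (by positivity)
  have hm : ‖v‖ ^ 2 * ∫ x, ‖fderiv ℝ u x‖ ^ 2 = ∫ x, ‖v‖ ^ 2 * ‖fderiv ℝ u x‖ ^ 2 :=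
    (integral_const_mul _ _).symm
  rw [hm, ofReal_integral_eq_lintegral_ofReal (hI.const_mul _)
    (Filter.Eventually.of_forall fun x => by positivity)]
  calc ∫⁻ x, ENNReal.ofReal (‖u (x + v) - u x‖ ^ 2)
      ≤ ∫⁻ x, ∫⁻ t in Set.Ioc (0:ℝ) 1,
          ENNReal.ofReal (‖v‖ ^ 2 * ‖fderiv ℝ u (x + t • v)‖ ^ 2) := by
        apply lintegral_mono
        intro x
        have h := aux_pointwise u hu v x
        rw [intervalIntegral.integral_of_le (by norm_num)] at h
        simp only
        rw [← ofReal_integral_eq_lintegral_ofReal]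
        · exact ENNReal.ofReal_le_ofReal h
        · exact (Continuous.integrableOn_Icc (by fun_prop)).mono_set Set.Ioc_subset_Icc_self
        · exact Filter.Eventually.of_forall fun x => by positivity
    _ = ∫⁻ t in Set.Ioc (0:ℝ) 1, ∫⁻ x,
          ENNReal.ofReal (‖v‖ ^ 2 * ‖fderiv ℝ u (x + t • v)‖ ^ 2) := by
        apply lintegral_lintegral_swap
        apply Measurable.aemeasurable
        apply Measurable.ennreal_ofReal
        apply Continuous.measurable
        fun_prop
    _ = ∫⁻ t in Set.Ioc (0:ℝ) 1, ∫⁻ x,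
          ENNReal.ofReal (‖v‖ ^ 2 * ‖fderiv ℝ u x‖ ^ 2) := by
        congr 1
        ext t
        exact lintegral_add_right_eq_self
          (fun x => ENNReal.ofReal (‖v‖ ^ 2 * ‖fderiv ℝ u x‖ ^ 2)) (t • v)
    _ ≤ _ := by simp

/-- **Lemma 3.5 (γ = 2/(2+β)): lower bound `‖∇u‖² + b‖a^{1/2}u‖² ≳ b^{2/(2+β)}‖u‖²`
as `b → 0⁺` under the polynomial growth condition (Assumption 3.2).** -/
theorem lower_bound_hb_polynomial_growth
    (d : ℕ) (hd : 1 ≤ d)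
    (Ω : Set (EuclideanSpace ℝ (Fin d))) (hΩopen : IsOpen Ω)
    (a : EuclideanSpace ℝ (Fin d) → ℝ)
    (ha_meas : Measurable a)
    (ha_nonneg : ∀ᵐ x, x ∈ Ω → 0 ≤ a x)
    (ha_loc : LocallyIntegrableOn a Ω)
    (β : ℝ) (hβ : 0 < β)
    (hgrowth : ∃ (r₀ c : ℝ), 0 < r₀ ∧ 0 < c ∧
      (ball (0 : EuclideanSpace ℝ (Fin d)) r₀)ᶜ ⊆ Ω ∧
      (∀ᵐ x, r₀ < ‖x‖ → c * ‖x‖ ^ β ≤ a x)) :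
    ∃ (b₀ C : ℝ), b₀ ∈ Set.Ioc (0 : ℝ) 1 ∧ 0 < C ∧
      ∀ b : ℝ, b ∈ Set.Ioc (0 : ℝ) b₀ →
      ∀ u : EuclideanSpace ℝ (Fin d) → ℂ,
        ContDiff ℝ (⊤ : ℕ∞) u → HasCompactSupport u → tsupport u ⊆ Ω →
        C * b ^ (2 / (2 + β)) * (∫ x, ‖u x‖ ^ 2)
          ≤ (∫ x, ‖fderiv ℝ u x‖ ^ 2) + b * (∫ x, a x * ‖u x‖ ^ 2) := by
  obtain ⟨r₀, c, hr₀, hc, -, hg⟩ := hgrowth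
  refine ⟨(r₀ + 1) ^ (-(2 + β)), (3 / c + 8)⁻¹,
    ⟨by positivity, Real.rpow_le_one_of_one_le_of_nonpos (by linarith) (by linarith)⟩,
    by positivity, ?_⟩
  rintro b ⟨hb0, hb⟩ u hu hs hsub
  have hu1 : ContDiff ℝ 1 u := hu.of_le (by exact_mod_cast le_top)
  have huc := hu1.continuous
  set R : ℝ := b ^ (-(1 / (2 + β))) with hR
  have hR0 : 0 < R := by positivity
  have hRr : r₀ < R := by
    have h1 : ((r₀ + 1) ^ (-(2 + β))) ^ (-(1 / (2 + β))) ≤ R :=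
      Real.rpow_le_rpow_of_nonpos hb0 hb (by rw [neg_nonpos]; positivity)
    rw [← Real.rpow_mul (by positivity)] at h1
    have h2 : -(2 + β) * -(1 / (2 + β)) = 1 := by field_simp
    rw [h2, Real.rpow_one] at h1
    linarith
  set v : EuclideanSpace ℝ (Fin d) := EuclideanSpace.single ⟨0, hd⟩ (2 * R) with hv
  have hvn : ‖v‖ = 2 * R := by
    rw [hv, EuclideanSpace.norm_single, Real.norm_of_nonneg (by positivity)]
  set S : Set (EuclideanSpace ℝ (Fin d)) := {x | R ≤ ‖x‖} with hS
  have hSm : MeasurableSet S := measurableSet_le measurable_const measurable_norm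
  set F : EuclideanSpace ℝ (Fin d) → ℝ := S.indicator (fun x => ‖u x‖ ^ 2) with hF
  have hsq : HasCompactSupport (fun x => ‖u x‖ ^ 2) :=
    hs.comp_left (g := fun y => ‖y‖ ^ 2) (by simp)
  have hUi : Integrable (fun x => ‖u x‖ ^ 2) :=
    Continuous.integrable_of_hasCompactSupport (by fun_prop) hsq
  have hFi : Integrable F := hUi.indicator hSm
  have hFvi : Integrable (fun x => F (x + v)) := hFi.comp_add_right v
  have hGi : Integrable (fun x => ‖u (x + v) - u x‖ ^ 2) := by
    apply Continuous.integrable_of_hasCompactSupport (by fun_prop)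
    have h1 : HasCompactSupport (fun x => u (x + v)) :=
      hs.comp_homeomorph (Homeomorph.addRight v)
    exact (h1.sub hs).comp_left (g := fun y => ‖y‖ ^ 2) (by simp)
  have hFn : ∀ x, 0 ≤ F x := fun x => Set.indicator_nonneg (fun _ _ => by positivity) x
  have hpt : ∀ x, ‖u x‖ ^ 2 ≤ F x + 2 * F (x + v) + 2 * ‖u (x + v) - u x‖ ^ 2 := by
    intro x
    by_cases hx : x ∈ S
    · have : F x = ‖u x‖ ^ 2 := Set.indicator_of_mem hx _
      have := hFn (x + v)
      have : 0 ≤ ‖u (x + v) - u x‖ ^ 2 := by positivity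
      linarith
    · have hx' : ‖x‖ < R := not_le.mp hx
      have hxv : x + v ∈ S := by
        have h := norm_sub_le (x + v) x
        rw [add_sub_cancel_left, hvn] at h
        show R ≤ ‖x + v‖
        linarith
      have h1 : F (x + v) = ‖u (x + v)‖ ^ 2 := Set.indicator_of_mem hxv _
      have h2 := norm_sub_le (u (x + v)) (u (x + v) - u x)
      rw [sub_sub_cancel] at h2
      have h3 := hFn x
      rw [h1]
      nlinarith [norm_nonneg (u x), norm_nonneg (u (x+v)), norm_nonneg (u (x+v) - u x),
        sq_nonneg (‖u (x+v)‖ - ‖u (x+v) - u x‖)]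
  have hmain : ∫ x, ‖u x‖ ^ 2 ≤ 3 * (∫ x, F x) + 8 * R ^ 2 * ∫ x, ‖fderiv ℝ u x‖ ^ 2 := by
    have h1 : ∫ x, ‖u x‖ ^ 2 ≤ ∫ x, (F x + 2 * F (x + v) + 2 * ‖u (x + v) - u x‖ ^ 2) :=
      integral_mono hUi ((hFi.add (hFvi.const_mul 2)).add (hGi.const_mul 2)) hpt
    have h0 : Integrable (fun x => F x + 2 * F (x + v)) := hFi.add (hFvi.const_mul 2)
    rw [integral_add h0 (hGi.const_mul 2),
      integral_add hFi (hFvi.const_mul 2), integral_const_mul, integral_const_mul,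
      integral_add_right_eq_self F v] at h1
    have h2 := aux_shift u hu1 hs v
    rw [hvn] at h2
    nlinarith
  have hAi : Integrable (fun x => a x * ‖u x‖ ^ 2) := by
    have hK : IntegrableOn a (tsupport u) := ha_loc.integrableOn_compact_subset hsub hs
    have h1 : IntegrableOn (fun x => a x * ‖u x‖ ^ 2) (tsupport u) :=
      hK.mul_continuousOn (by fun_prop) hs
    rw [integrableOn_iff_integrable_of_support_subset] at h1
    · exact h1
    · intro x hx
      apply subset_tsupport u
      intro h0
      apply hx
      simp [h0]
  have hAF : c * R ^ β * (∫ x, F x) ≤ ∫ x, a x * ‖u x‖ ^ 2 := by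
    rw [← integral_const_mul]
    apply integral_mono_ae (hFi.const_mul _) hAi
    filter_upwards [ha_nonneg, hg] with x hx1 hx2
    by_cases hx : x ∈ S
    · have : F x = ‖u x‖ ^ 2 := Set.indicator_of_mem hx _
      rw [this]
      have hx' : R ≤ ‖x‖ := hx
      have h3 : c * R ^ β ≤ a x :=
        le_trans (by gcongr) (hx2 (by linarith))
      gcongr
    · have : F x = 0 := Set.indicator_of_notMem hx _
      rw [this, mul_zero]
      by_cases hxs : x ∈ tsupport u
      · exact mul_nonneg (hx1 (hsub hxs)) (by positivity)
      · simp [image_eq_zero_of_notMem_tsupport hxs]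
  set p := b ^ (2 / (2 + β)) with hp
  have hp0 : 0 < p := by positivity
  have hpR : p * R ^ 2 = 1 := by
    rw [hp, hR, ← Real.rpow_natCast, ← Real.rpow_mul hb0.le, ← Real.rpow_add hb0]
    have : 2 / (2 + β) + -(1 / (2 + β)) * ((2:ℕ):ℝ) = 0 := by push_cast; ring
    rw [this, Real.rpow_zero]
  have hpb : p = b * R ^ β := by
    rw [hp, hR, ← Real.rpow_mul hb0.le]
    nth_rewrite 2 [← Real.rpow_one b]
    rw [← Real.rpow_add hb0]
    congr 1
    field_simp
    ring
  set I := ∫ x, F x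
  set A := ∫ x, a x * ‖u x‖ ^ 2
  set D := ∫ x, ‖fderiv ℝ u x‖ ^ 2
  have hD : 0 ≤ D := integral_nonneg fun x => by positivity
  have hI : 0 ≤ I := integral_nonneg hFn
  have hpI : p * I ≤ b * A / c := by
    rw [le_div_iff₀ hc, hpb]
    calc b * R ^ β * I * c = b * (c * R ^ β * I) := by ring
      _ ≤ b * A := by gcongr
  have hA : 0 ≤ b * A / c := le_trans (by positivity) hpI
  have hbA : 0 ≤ b * A := by
    have := mul_nonneg hA hc.le
    rwa [div_mul_cancel₀ _ hc.ne'] at this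
  rw [mul_assoc, inv_mul_le_iff₀ (by positivity)]
  calc p * ∫ x, ‖u x‖ ^ 2 ≤ p * (3 * I + 8 * R ^ 2 * D) := by gcongr
    _ = 3 * (p * I) + 8 * (p * R ^ 2) * D := by ring
    _ ≤ 3 * (b * A / c) + 8 * D := by rw [hpR]; linarith
    _ ≤ (3 / c + 8) * (D + b * A) := by
      have h1 : 0 ≤ 3 / c * D := by positivity
      have h2 : 3 * (b * A / c) = 3 / c * (b * A) := by ring
      rw [h2]
      nlinarith
end

section
/- Fix d ≥ 1 and j ∈ {0, 1, 2}, and set c_j := ((j+1)/(2e))^{(j+1)/2}. Let T₀ > 0 and ρ : [T₀,∞) → [0,∞) be such that for every measurable g : ℝ^d → ℂ with W(g) := ∫_{ℝ^d} (‖ξ‖² + 1 + ‖ξ‖^{−2}) |g(ξ)|² dξ < ∞ and every t ≥ T₀: ∫_{ℝ^d} ‖ξ‖^{2j} e^{−2t‖ξ‖²} |g(ξ)|² dξ ≤ ρ(t)² W(g). Then for every ε > 0 there exists t₀ ≥ T₀ such that for all t ≥ t₀: ρ(t) ≥ (c_j − ε) t^{−(j+1)/2}. -/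
open MeasureTheory

lemma heat_pointwise {E : Type*} [NormedAddCommGroup E] [NormedSpace ℝ E] [FiniteDimensional ℝ E]
    [MeasureSpace E] [BorelSpace E] [(volume : Measure E).IsAddHaarMeasure]
    (A W : E → ℝ) (R : ℝ) (x : E) (U : Set E) (hU : IsOpen U) (hx : x ∈ U)
    (hA : ContinuousOn A U) (hW : ContinuousOn W U)
    (h : ∀ g : E → ℂ, Measurable g → Integrable (fun ξ => W ξ * ‖g ξ‖ ^ 2) →
      (∫ ξ, A ξ * ‖g ξ‖ ^ 2) ≤ R * ∫ ξ, W ξ * ‖g ξ‖ ^ 2) : A x ≤ R * W x := by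
  by_contra hc
  push Not at hc
  have hF : ContinuousOn (fun ξ => A ξ - R * W ξ) U := hA.sub (continuousOn_const.mul hW)
  obtain ⟨c, hc0, hc1⟩ : ∃ c, 0 < c ∧ c < A x - R * W x := exists_between (by linarith)
  have hev : ∀ᶠ ξ in nhds x, ξ ∈ U ∧ c < A ξ - R * W ξ :=
    Filter.Eventually.and (hU.mem_nhds hx) ((hF.continuousAt (hU.mem_nhds hx)).eventually (lt_mem_nhds hc1))
  obtain ⟨δ, hδ, hB⟩ := Metric.nhds_basis_closedBall.mem_iff.1 hev
  set B := Metric.closedBall x δ with hBdef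
  have hBm : MeasurableSet B := Metric.isClosed_closedBall.measurableSet
  have hBc : IsCompact B := isCompact_closedBall x δ
  have hBU : B ⊆ U := fun y hy => (hB hy).1
  have key : ∀ H : E → ℝ, (fun ξ => H ξ * ‖B.indicator (fun _ => (1 : ℂ)) ξ‖ ^ 2)
      = B.indicator H := by
    intro H
    ext ξ
    by_cases hξ : ξ ∈ B <;> simp [hξ]
  have hAi : IntegrableOn A B := (hA.mono hBU).integrableOn_compact hBc
  have hWi : IntegrableOn W B := (hW.mono hBU).integrableOn_compact hBc
  have h1 := h (B.indicator (fun _ => (1 : ℂ))) (measurable_const.indicator hBm)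
    (by rw [key]; exact hWi.integrable_indicator hBm)
  rw [key, key, integral_indicator hBm, integral_indicator hBm] at h1
  have h2 : ∫ ξ in B, c ≤ ∫ ξ in B, (A ξ - R * W ξ) :=
    setIntegral_mono_on (integrableOn_const hBc.measure_lt_top.ne)
      (hAi.sub (hWi.const_mul R)) hBm (fun y hy => (hB hy).2.le)
  rw [integral_sub hAi (hWi.const_mul R), integral_const_mul, setIntegral_const, smul_eq_mul] at h2
  have h3 : 0 < (volume : Measure E).real B :=
    ENNReal.toReal_pos (Metric.measure_closedBall_pos _ _ hδ).ne' hBc.measure_lt_top.ne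
  have := mul_pos h3 hc0
  linarith

/-- **Lemma 6.3 (optimality of the heat semigroup decay rates from `𝖪 = H¹ ∩ Ḣ⁻¹` to `L²`),
on the Fourier side via Plancherel.** -/
theorem heat_semigroup_decay_optimal
    (d : ℕ) (hd : 1 ≤ d) (j : ℕ) (hj : j ≤ 2)
    (T₀ : ℝ) (hT₀ : 0 < T₀)
    (ρ : ℝ → ℝ) (hρ_nonneg : ∀ t : ℝ, T₀ ≤ t → 0 ≤ ρ t)
    (hρ : ∀ g : EuclideanSpace ℝ (Fin d) → ℂ, Measurable g →
      Integrable (fun ξ : EuclideanSpace ℝ (Fin d) =>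
        (‖ξ‖ ^ 2 + 1 + (‖ξ‖ ^ 2)⁻¹) * ‖g ξ‖ ^ 2) →
      ∀ t : ℝ, T₀ ≤ t →
        (∫ ξ : EuclideanSpace ℝ (Fin d),
            ‖ξ‖ ^ (2 * j) * Real.exp (-(2 * t * ‖ξ‖ ^ 2)) * ‖g ξ‖ ^ 2)
          ≤ ρ t ^ 2 * ∫ ξ : EuclideanSpace ℝ (Fin d),
              (‖ξ‖ ^ 2 + 1 + (‖ξ‖ ^ 2)⁻¹) * ‖g ξ‖ ^ 2) :
    ∀ ε : ℝ, 0 < ε → ∃ t₀ : ℝ, T₀ ≤ t₀ ∧ ∀ t : ℝ, t₀ ≤ t →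
      ((((j : ℝ) + 1) / (2 * Real.exp 1)) ^ (((j : ℝ) + 1) / 2) - ε)
          * t ^ (-((j : ℝ) + 1) / 2) ≤ ρ t := by
  have hpt : ∀ t, T₀ ≤ t → ∀ r : ℝ, 0 < r →
      r ^ (2 * j) * Real.exp (-(2 * t * r ^ 2)) ≤ ρ t ^ 2 * (r ^ 2 + 1 + (r ^ 2)⁻¹) := by
    intro t ht r hr
    have hx : ‖EuclideanSpace.single (⟨0, hd⟩ : Fin d) r‖ = r := by
      simp [abs_of_pos hr]
    have := heat_pointwise
      (fun ξ : EuclideanSpace ℝ (Fin d) => ‖ξ‖ ^ (2 * j) * Real.exp (-(2 * t * ‖ξ‖ ^ 2)))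
      (fun ξ => ‖ξ‖ ^ 2 + 1 + (‖ξ‖ ^ 2)⁻¹) (ρ t ^ 2)
      (EuclideanSpace.single (⟨0, hd⟩ : Fin d) r) {0}ᶜ isOpen_compl_singleton
      (by
        intro h0
        rw [Set.mem_singleton_iff.1 h0, norm_zero] at hx
        exact hr.ne hx)
      (Continuous.continuousOn (by fun_prop))
      (ContinuousOn.add (Continuous.continuousOn (by fun_prop))
        (ContinuousOn.inv₀ (Continuous.continuousOn (by fun_prop))
          (fun y hy => pow_ne_zero _ (norm_ne_zero_iff.2 hy))))
      (fun g hg hi => hρ g hg hi t ht)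
    simpa only [hx] using this
  intro ε hε
  set c : ℝ := (((j : ℝ) + 1) / (2 * Real.exp 1)) ^ (((j : ℝ) + 1) / 2) with hc
  obtain ⟨s, hs⟩ : ∃ s : ℝ, s = ((j : ℝ) + 1) / 2 := ⟨_, rfl⟩
  have hs0 : 0 < s := by rw [hs]; positivity
  refine ⟨max T₀ (c * s / ε), le_max_left _ _, fun t ht => ?_⟩
  have hT : T₀ ≤ t := (le_max_left _ _).trans ht
  have ht2 : c * s / ε ≤ t := (le_max_right _ _).trans ht
  have ht0 : 0 < t := hT₀.trans_le hT
  have hρ0 := hρ_nonneg t hT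
  set m : ℝ := t ^ (-((j : ℝ) + 1) / 2) with hm
  have hm0 : 0 < m := Real.rpow_pos_of_pos ht0 _
  have hc0 : 0 < c := Real.rpow_pos_of_pos (by positivity) _
  have hm2 : m ^ 2 = (t ^ (j + 1))⁻¹ := by
    rw [hm, ← Real.rpow_natCast, ← Real.rpow_mul ht0.le, ← Real.rpow_natCast, ← Real.rpow_neg ht0.le]
    congr 1
    push_cast
    ring
  have hc2 : c ^ 2 = s ^ (j + 1) * Real.exp (-(2 * s)) := by
    have e1 : c ^ 2 = (s / Real.exp 1) ^ (j + 1) := by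
      rw [hc, ← Real.rpow_natCast, ← Real.rpow_mul (by positivity), ← Real.rpow_natCast]
      congr 1
      · rw [hs]; field_simp
      · push_cast; ring
    rw [e1, div_pow, ← Real.exp_nat_mul, Real.exp_neg, div_eq_mul_inv]
    congr 3
    rw [hs]; push_cast; ring
  set u := s / t with hu
  have hu0 : 0 < u := by positivity
  have h1 := hpt t hT (Real.sqrt u) (Real.sqrt_pos.2 hu0)
  rw [pow_mul, Real.sq_sqrt hu0.le] at h1
  have e2 : 2 * t * u = 2 * s := by rw [hu]; field_simp
  rw [e2] at h1
  have h2 : (c * m) ^ 2 ≤ (ρ t * (1 + u)) ^ 2 := by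
    calc (c * m) ^ 2 = u * (u ^ j * Real.exp (-(2 * s))) := by
          rw [mul_pow, hc2, hm2, ← mul_assoc, ← pow_succ', hu, div_pow]; ring
      _ ≤ u * (ρ t ^ 2 * (u + 1 + u⁻¹)) := by gcongr
      _ = ρ t ^ 2 * (u ^ 2 + u + 1) := by field_simp
      _ ≤ ρ t ^ 2 * (1 + u) ^ 2 := by gcongr; nlinarith
      _ = _ := by ring
  have h3 : c * m ≤ ρ t * (1 + u) := le_of_abs_le (abs_le_of_sq_le_sq h2 (by positivity))
  have h4 : c * u ≤ ε := by
    rw [hu, ← mul_div_assoc, div_le_iff₀ ht0]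
    rw [div_le_iff₀ hε] at ht2
    linarith
  have h5 : (c - ε) * m * (1 + u) ≤ ρ t * (1 + u) := by
    refine le_trans ?_ h3
    have : (c - ε) * (1 + u) ≤ c := by nlinarith [mul_pos hε hu0]
    nlinarith
  exact le_of_mul_le_mul_right h5 (by positivity)
end

section
/- Let d ≥ 1 and β > 0. There exists c > 0 such that for every smooth function w : ℝ^d → ℂ: ∫_{B(0,1)} ‖Dw(x)‖² dx + ∫_{1/2 < ‖y‖ < 1} ‖y‖^β |w(y)|² dy ≥ c ∫_{B(0,1)} |w(x)|² dx, where B(0,1) is the open unit ball and Dw the Fréchet derivative. -/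
open MeasureTheory Metric

/-- **Key rescaled lower bound in the proof of Lemma 3.5 under Assumption 3.2:** the
Neumann form of `−Δ + 𝟙_𝔹 |y|^β` on the unit ball (with `𝔹` the annulus
`1/2 < ‖y‖ < 1`) controls the `L²` norm on the unit ball. -/
theorem annulus_neumann_lower_bound
    (d : ℕ) (hd : 1 ≤ d) (β : ℝ) (hβ : 0 < β) :
    ∃ c : ℝ, 0 < c ∧
      ∀ w : EuclideanSpace ℝ (Fin d) → ℂ, ContDiff ℝ (⊤ : ℕ∞) w →
        c * ∫ x in ball (0 : EuclideanSpace ℝ (Fin d)) 1, ‖w x‖ ^ 2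
          ≤ (∫ x in ball (0 : EuclideanSpace ℝ (Fin d)) 1, ‖fderiv ℝ w x‖ ^ 2)
            + ∫ y in {y : EuclideanSpace ℝ (Fin d) | 1 / 2 < ‖y‖ ∧ ‖y‖ < 1},
                ‖y‖ ^ β * ‖w y‖ ^ 2 := by
  obtain ⟨e, L, he, hLe, hL⟩ : ∃ (e : EuclideanSpace ℝ (Fin d))
      (L : EuclideanSpace ℝ (Fin d) →L[ℝ] ℝ), ‖e‖ = 1 ∧ L e = 1 ∧ ∀ x, |L x| ≤ ‖x‖ :=
    ⟨EuclideanSpace.single ⟨0, hd⟩ 1, EuclideanSpace.proj ⟨0, hd⟩, by simp, by simp,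
      fun x => by simpa using PiLp.norm_apply_le x ⟨0, hd⟩⟩
  let E := EuclideanSpace ℝ (Fin d)
  let χ : ContDiffBump (0 : E) := ⟨3/5, 4/5, by norm_num, by norm_num⟩
  have hχs : ContDiff ℝ 1 (χ : E → ℝ) := χ.contDiff
  have hχc : HasCompactSupport (χ : E → ℝ) := χ.hasCompactSupport
  have hDc : Continuous (fun x => fderiv ℝ (χ : E → ℝ) x e) :=
    (hχs.continuous_fderiv one_ne_zero).clm_apply continuous_const
  have hDcs : HasCompactSupport (fun x => fderiv ℝ (χ : E → ℝ) x e) := hχc.fderiv_apply ℝ e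
  obtain ⟨M, hM⟩ := hDcs.exists_bound_of_continuous hDc
  have hM0 : 0 ≤ M := (norm_nonneg _).trans (hM 0)
  let K : ℝ := (M + 1) / (1/2 : ℝ) ^ β
  have hp : 0 < (1/2 : ℝ) ^ β := by positivity
  have hK : 0 < K := by positivity
  have hKp : K * (1/2 : ℝ) ^ β = M + 1 := by simp only [K]; field_simp
  refine ⟨1 / (2 * (2 + K)), by positivity, fun w hw => ?_⟩
  set A : Set E := {y : E | 1 / 2 < ‖y‖ ∧ ‖y‖ < 1} with hA
  have hAm : MeasurableSet A :=
    (measurableSet_lt measurable_const measurable_norm).inter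
      (measurableSet_lt measurable_norm measurable_const)
  have hAB : A ⊆ ball 0 1 := fun y hy => by simpa using hy.2
  have hw1 : ContDiff ℝ 1 w := hw.of_le (by exact_mod_cast le_top)
  have hwd : Differentiable ℝ w := hw1.differentiable one_ne_zero
  have hwc : Continuous w := hw1.continuous
  have hDw : Continuous (fderiv ℝ w) := hw1.continuous_fderiv one_ne_zero
  let φ : E → ℝ := fun x => χ x * L x
  let g : E → ℝ := fun x => ‖w x‖ ^ 2
  have hφs : ContDiff ℝ 1 φ := hχs.mul L.contDiff
  have hφc : HasCompactSupport φ := hχc.mul_right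
  have hgs : ContDiff ℝ 1 g := hw1.norm_sq ℝ
  have hφD : ∀ x, fderiv ℝ φ x e = χ x + L x * fderiv ℝ (χ : E → ℝ) x e := fun x => by
    have := ((hχs.differentiable one_ne_zero x).hasFDerivAt.mul (L.hasFDerivAt (x := x))).fderiv
    change fderiv ℝ φ x = _ at this
    rw [this]; simp [hLe]
  have hgD : ∀ x, |fderiv ℝ g x e| ≤ 2 * ‖w x‖ * ‖fderiv ℝ w x‖ := fun x => by
    have := ((hwd x).hasFDerivAt.norm_sq).fderiv
    change fderiv ℝ g x = _ at this
    rw [this]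
    have h1 : |inner ℝ (w x) (fderiv ℝ w x e)| ≤ ‖w x‖ * ‖fderiv ℝ w x‖ := by
      refine (abs_real_inner_le_norm _ _).trans ?_
      gcongr
      simpa [he] using (fderiv ℝ w x).le_opNorm e
    have h2 : (2 • (innerSL ℝ (w x)).comp (fderiv ℝ w x)) e
        = 2 * inner ℝ (w x) (fderiv ℝ w x e) := by
      rw [two_smul, two_mul]; rfl
    rw [h2, abs_mul, abs_two]
    linarith
  have hφDc : Continuous (fun x => fderiv ℝ φ x e) :=
    (hφs.continuous_fderiv one_ne_zero).clm_apply continuous_const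
  have hgDc : Continuous (fun x => fderiv ℝ g x e) :=
    (hgs.continuous_fderiv one_ne_zero).clm_apply continuous_const
  have hφDcs : HasCompactSupport (fun x => fderiv ℝ φ x e) := hφc.fderiv_apply ℝ e
  have i1 : Integrable (fun x => fderiv ℝ φ x e * g x) :=
    (hφDc.mul hgs.continuous).integrable_of_hasCompactSupport hφDcs.mul_right
  have i2 : Integrable (fun x => φ x * fderiv ℝ g x e) :=
    (hφs.continuous.mul hgDc).integrable_of_hasCompactSupport hφc.mul_right
  have i3 : Integrable (fun x => φ x * g x) :=
    (hφs.continuous.mul hgs.continuous).integrable_of_hasCompactSupport hφc.mul_right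
  have key := integral_mul_fderiv_eq_neg_fderiv_mul_of_integrable i1 i2 i3
    (fun x _ => hφs.differentiable one_ne_zero x) (fun x _ => hgs.differentiable one_ne_zero x)
  let G : E → ℝ := fun x => fderiv ℝ φ x e * g x + φ x * fderiv ℝ g x e
  have hG : Integrable G := i1.add i2
  have hG0 : ∫ x, G x = 0 := by
    simp only [G]
    rw [integral_add i1 i2, key]; ring
  have hχ0 : ∀ x : E, 1 ≤ ‖x‖ → χ x = 0 := fun x hx => by
    apply χ.zero_of_le_dist; simp [χ]; linarith
  have hDχ0 : ∀ x : E, 1 ≤ ‖x‖ → fderiv ℝ (χ : E → ℝ) x e = 0 := fun x hx => by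
    have : x ∉ tsupport (χ : E → ℝ) := by
      rw [χ.tsupport_eq]; simp [χ]; linarith
    rw [fderiv_of_notMem_tsupport ℝ this]; simp
  have hχ1 : ∀ x : E, ‖x‖ ≤ 1/2 → χ x = 1 := fun x hx => by
    apply χ.one_of_mem_closedBall; simp [χ]; linarith
  have hDχ1 : ∀ x : E, ‖x‖ ≤ 1/2 → fderiv ℝ (χ : E → ℝ) x e = 0 := fun x hx => by
    have : (χ : E → ℝ) =ᶠ[nhds x] fun _ => (1:ℝ) := χ.eventuallyEq_one_of_mem_ball (by simp [χ]; linarith)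
    rw [this.fderiv_eq]; simp
  have hGB : ∫ x in ball (0 : E) 1, G x = 0 := by
    rw [setIntegral_eq_integral_of_forall_compl_eq_zero, hG0]
    intro x hx
    have hx : 1 ≤ ‖x‖ := by simpa using hx
    simp [G, hφD, φ, hχ0 x hx, hDχ0 x hx]
  have hBi : ∀ f : E → ℝ, Continuous f → IntegrableOn f (ball 0 1) := fun f hf =>
    (hf.continuousOn.integrableOn_compact (isCompact_closedBall 0 1)).mono_set ball_subset_closedBall
  have j1 := hBi _ hgs.continuous
  have j2 := hBi (fun x => ‖fderiv ℝ w x‖ ^ 2) (by fun_prop)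
  let h : E → ℝ := fun y => ‖y‖ ^ β * ‖w y‖ ^ 2
  have hh : Continuous h := by
    refine Continuous.mul (continuous_norm.rpow_const fun x => Or.inr hβ.le) (by fun_prop)
  have j3 : IntegrableOn (A.indicator h) (ball 0 1) := (hBi h hh).indicator hAm
  have hpt : ∀ x ∈ ball (0:E) 1, 1/2 * g x ≤ G x + (2 * ‖fderiv ℝ w x‖ ^ 2 + K * A.indicator h x) := by
    intro x hx
    have hx : ‖x‖ < 1 := by simpa using hx
    have a0 := χ.nonneg (x := x)
    have a1 := χ.le_one (x := x)
    have a2 : |L x| ≤ 1 := (hL x).trans hx.le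
    have a3 : |φ x * fderiv ℝ g x e| ≤ 2 * ‖w x‖ * ‖fderiv ℝ w x‖ := by
      have : |φ x| ≤ 1 := by
        simp only [φ, abs_mul, abs_of_nonneg a0]
        exact mul_le_one₀ a1 (abs_nonneg _) a2
      rw [abs_mul]
      exact (mul_le_of_le_one_left (abs_nonneg _) this).trans (hgD x)
    have a4 : 2 * ‖w x‖ * ‖fderiv ℝ w x‖ ≤ 1/2 * g x + 2 * ‖fderiv ℝ w x‖ ^ 2 := by
      simp only [g]; nlinarith [sq_nonneg (‖w x‖ - 2 * ‖fderiv ℝ w x‖)]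
    have a5 := (abs_le.1 a3).1
    have g0 : 0 ≤ g x := by positivity
    by_cases hxA : ‖x‖ ≤ 1/2
    · have : x ∉ A := fun h => by have := h.1; linarith
      simp only [G, hφD, hχ1 x hxA, hDχ1 x hxA, Set.indicator_of_notMem this]
      linarith
    · have hxA' : x ∈ A := ⟨not_le.1 hxA, hx⟩
      have b1 : |L x * fderiv ℝ (χ : E → ℝ) x e| ≤ M := by
        rw [abs_mul]
        exact (mul_le_of_le_one_left (abs_nonneg _) a2).trans (hM x)
      have b2 := (abs_le.1 b1).1
      have b3 : (M + 1) * g x ≤ K * h x := by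
        rw [← hKp, mul_assoc]
        have : (1/2:ℝ) ^ β ≤ ‖x‖ ^ β := Real.rpow_le_rpow (by norm_num) (not_le.1 hxA).le hβ.le
        simp only [h]
        gcongr
      simp only [G, hφD, Set.indicator_of_mem hxA']
      nlinarith [mul_le_mul_of_nonneg_right b2 g0, mul_nonneg a0 g0]
  have j4 : IntegrableOn (fun x => 2 * ‖fderiv ℝ w x‖ ^ 2 + K * A.indicator h x) (ball 0 1) :=
    (j2.const_mul 2).add (j3.const_mul K)
  have hint := setIntegral_mono_on (μ := volume) (j1.const_mul (1/2))
    (hG.integrableOn.add j4) measurableSet_ball hpt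
  have hsum : ∫ x in ball (0:E) 1, (G x + (2 * ‖fderiv ℝ w x‖ ^ 2 + K * A.indicator h x))
      = 2 * (∫ x in ball (0:E) 1, ‖fderiv ℝ w x‖ ^ 2) + K * ∫ x in A, h x := by
    rw [integral_add hG.integrableOn j4, hGB,
      integral_add (j2.const_mul 2) (j3.const_mul K), integral_const_mul, integral_const_mul,
      setIntegral_indicator hAm, Set.inter_eq_self_of_subset_right hAB, zero_add]
  have hint2 : 1/2 * ∫ x in ball (0:E) 1, g x ≤ 2 * (∫ x in ball (0:E) 1, ‖fderiv ℝ w x‖ ^ 2) + K * ∫ x in A, h x := by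
    rw [← hsum, ← integral_const_mul]; exact hint
  have p1 : 0 ≤ ∫ x in ball (0:E) 1, ‖fderiv ℝ w x‖ ^ 2 := integral_nonneg fun x => by positivity
  have p2 : 0 ≤ ∫ x in A, h x := integral_nonneg fun x => by positivity
  change 1 / (2 * (2 + K)) * (∫ x in ball (0:E) 1, g x) ≤ _ + ∫ x in A, h x
  rw [one_div_mul_eq_div, div_le_iff₀ (by positivity)]
  nlinarith [mul_nonneg hK.le p1]
end

section
/- Let d ≥ 1, let B = B(x₀, r₀) ⊆ ℝ^d be a nonempty open ball, and let a : ℝ^d → ℝ be measurable with a ≥ 0 a.e. on B, a integrable on B and ∫_B a(x) dx > 0. Then there exist b₀ > 0 and c > 0 such that for every b ∈ (0, b₀] and every smooth function w : ℝ^d → ℂ: ∫_B ‖Dw(x)‖² dx + b ∫_B a(x)|w(x)|² dx ≥ c b ∫_B |w(x)|² dx. -/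
open MeasureTheory Metric

open scoped ENNReal

lemma npb_sq_lintegral_le {α : Type*} [MeasurableSpace α] (μ : Measure α) [IsProbabilityMeasure μ]
    (f : α → ℝ≥0∞) (hf : AEMeasurable f μ) :
    (∫⁻ t, f t ∂μ) ^ 2 ≤ ∫⁻ t, f t ^ 2 ∂μ := by
  have h := ENNReal.lintegral_mul_le_Lp_mul_Lq μ (p := 2) (q := 2)
    Real.HolderConjugate.two_two hf (aemeasurable_const (b := (1 : ℝ≥0∞)))
  simp only [Pi.mul_apply, mul_one, ENNReal.one_rpow, lintegral_const, measure_univ] at h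
  calc (∫⁻ t, f t ∂μ) ^ 2 ≤ ((∫⁻ t, f t ^ (2 : ℝ) ∂μ) ^ (1 / 2 : ℝ)) ^ 2 := by gcongr
    _ = ∫⁻ t, f t ^ (2 : ℝ) ∂μ := by
      rw [← ENNReal.rpow_natCast, ← ENNReal.rpow_mul]; norm_num
    _ = _ := by simp

lemma npb_scale {d : ℕ} (G : EuclideanSpace ℝ (Fin d) → ℝ≥0∞) (hG : Measurable G)
    (t : ℝ) (ht : 1 / 2 ≤ t) (z : EuclideanSpace ℝ (Fin d)) :
    ∫⁻ y, G (z + t • y) ≤ 2 ^ d * ∫⁻ y, G y := by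
  have ht0 : t ≠ 0 := by intro h; rw [h] at ht; norm_num at ht
  have h1 : ∫⁻ y, G (z + t • y) =
      ∫⁻ y, G (z + y) ∂(Measure.map (fun y : EuclideanSpace ℝ (Fin d) => t • y) volume) := by
    rw [lintegral_map (by fun_prop) (by fun_prop)]
  rw [h1, Measure.map_addHaar_smul volume ht0, lintegral_smul_measure,
    lintegral_add_left_eq_self (μ := volume) G z, smul_eq_mul]
  gcongr
  rw [finrank_euclideanSpace, Fintype.card_fin, ← inv_pow, abs_pow,
    abs_of_pos (by positivity), ENNReal.ofReal_pow (by positivity)]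
  gcongr
  rw [← ENNReal.ofReal_ofNat 2]
  apply ENNReal.ofReal_le_ofReal
  rw [inv_le_comm₀ (by linarith) (by norm_num)]
  simpa using ht

lemma npb_ftc {d : ℕ} (w : EuclideanSpace ℝ (Fin d) → ℂ) (hw : ContDiff ℝ (⊤ : ℕ∞) w)
    (x y : EuclideanSpace ℝ (Fin d)) :
    ‖w x - w y‖ₑ ^ 2 ≤ ‖x - y‖ₑ ^ 2 *
      ∫⁻ t in Set.Ioc (0 : ℝ) 1, ‖fderiv ℝ w ((1 - t) • x + t • y)‖ₑ ^ 2 := by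
  have hc : Continuous (fderiv ℝ w) := hw.continuous_fderiv (by simp)
  have hd : ∀ t : ℝ, HasDerivAt (fun t : ℝ => w ((1 - t) • x + t • y))
      (fderiv ℝ w ((1 - t) • x + t • y) (y - x)) t := by
    intro t
    have h1 : HasDerivAt (fun t : ℝ => (1 - t) • x + t • y) (y - x) t := by
      have := (((hasDerivAt_id t).const_sub 1).smul_const x).add ((hasDerivAt_id t).smul_const y)
      have e : y - x = (-1 : ℝ) • x + (1 : ℝ) • y := by
        rw [neg_one_smul, one_smul]; abel
      rw [e]
      exact this
    exact ((hw.differentiable (by simp)) _).hasFDerivAt.comp_hasDerivAt t h1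
  have hcont : Continuous fun t : ℝ => fderiv ℝ w ((1 - t) • x + t • y) := by fun_prop
  have hF := intervalIntegral.integral_eq_sub_of_hasDerivAt (a := 0) (b := 1)
    (fun t _ => hd t) ((hcont.clm_apply continuous_const).intervalIntegrable 0 1)
  simp only [sub_self, zero_smul, one_smul, zero_add, sub_zero, add_zero] at hF
  rw [intervalIntegral.integral_of_le zero_le_one] at hF
  have : IsProbabilityMeasure (volume.restrict (Set.Ioc (0 : ℝ) 1)) := ⟨by simp⟩
  have hxy : ‖y - x‖ₑ = ‖x - y‖ₑ := by rw [← enorm_neg, neg_sub]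
  calc ‖w x - w y‖ₑ ^ 2 = ‖w y - w x‖ₑ ^ 2 := by rw [← enorm_neg, neg_sub]
    _ ≤ (∫⁻ t in Set.Ioc (0 : ℝ) 1, ‖fderiv ℝ w ((1 - t) • x + t • y) (y - x)‖ₑ) ^ 2 := by
      rw [← hF]; gcongr; exact enorm_integral_le_lintegral_enorm _
    _ ≤ (∫⁻ t in Set.Ioc (0 : ℝ) 1, ‖fderiv ℝ w ((1 - t) • x + t • y)‖ₑ * ‖x - y‖ₑ) ^ 2 := by
      gcongr with t
      rw [← hxy]
      exact ContinuousLinearMap.le_opENorm _ _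
    _ = ‖x - y‖ₑ ^ 2 * (∫⁻ t in Set.Ioc (0 : ℝ) 1, ‖fderiv ℝ w ((1 - t) • x + t • y)‖ₑ) ^ 2 := by
      rw [lintegral_mul_const' _ _ enorm_ne_top, mul_pow, mul_comm]
    _ ≤ _ := by
      gcongr
      exact npb_sq_lintegral_le _ _ hcont.enorm.measurable.aemeasurable

lemma npb_double {d : ℕ} (x₀ : EuclideanSpace ℝ (Fin d)) (r : ℝ)
    (w : EuclideanSpace ℝ (Fin d) → ℂ) (hw : ContDiff ℝ (⊤ : ℕ∞) w) :
    ∫⁻ x in ball x₀ r, ∫⁻ y in ball x₀ r, ‖w x - w y‖ₑ ^ 2 ≤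
      ENNReal.ofReal (2 * r) ^ 2 * (2 ^ d * volume (ball x₀ r)) *
        ∫⁻ x in ball x₀ r, ‖fderiv ℝ w x‖ₑ ^ 2 := by
  have hc : Continuous (fderiv ℝ w) := hw.continuous_fderiv (by simp)
  set B := ball x₀ r with hB
  have hBm : MeasurableSet B := measurableSet_ball
  set G : EuclideanSpace ℝ (Fin d) → ℝ≥0∞ := B.indicator (fun x => ‖fderiv ℝ w x‖ₑ ^ 2) with hGdef
  have hG : Measurable G := (by fun_prop : Continuous fun x => ‖fderiv ℝ w x‖ₑ ^ 2).measurable.indicator hBm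
  have hGint : ∫⁻ x, G x = ∫⁻ x in B, ‖fderiv ℝ w x‖ₑ ^ 2 := lintegral_indicator hBm _
  have key : ∀ t ∈ Set.Ioc (0 : ℝ) 1, ∫⁻ x in B, ∫⁻ y in B, G ((1 - t) • x + t • y) ≤
      (2 ^ d * volume B) * ∫⁻ x, G x := by
    intro t ht
    have gen : ∀ s : ℝ, 1 / 2 ≤ s → ∫⁻ x in B, ∫⁻ y in B, G ((1 - s) • x + s • y) ≤
      (2 ^ d * volume B) * ∫⁻ x, G x := by
      intro s hs
      calc _ ≤ ∫⁻ x in B, 2 ^ d * ∫⁻ y, G y := by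
            gcongr with x
            exact (setLIntegral_le_lintegral _ _).trans (npb_scale G hG s hs _)
        _ = _ := by rw [setLIntegral_const]; ring
    rcases le_total (1 / 2) t with h | h
    · exact gen t h
    · rw [lintegral_lintegral_swap (by fun_prop)]
      have := gen (1 - t) (by linarith)
      simpa [add_comm] using this
  calc ∫⁻ x in B, ∫⁻ y in B, ‖w x - w y‖ₑ ^ 2
      ≤ ∫⁻ x in B, ∫⁻ y in B, ENNReal.ofReal (2 * r) ^ 2 *
          ∫⁻ t in Set.Ioc (0 : ℝ) 1, G ((1 - t) • x + t • y) := by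
        refine setLIntegral_mono' hBm fun x hx => setLIntegral_mono' hBm fun y hy => ?_
        refine (npb_ftc w hw x y).trans ?_
        gcongr ?_ ^ 2 * ?_
        · rw [← ofReal_norm, ← dist_eq_norm]
          apply ENNReal.ofReal_le_ofReal
          have h1 := mem_ball.1 hx
          have h2 := mem_ball'.1 hy
          linarith [dist_triangle x x₀ y]
        · refine setLIntegral_mono' measurableSet_Ioc fun t ht => ?_
          have : (1 - t) • x + t • y ∈ B :=
            (convex_ball x₀ r) hx hy (by linarith [ht.2]) ht.1.le (by ring)
          rw [hGdef, Set.indicator_of_mem this]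
    _ = ENNReal.ofReal (2 * r) ^ 2 * ∫⁻ x in B, ∫⁻ y in B,
          ∫⁻ t in Set.Ioc (0 : ℝ) 1, G ((1 - t) • x + t • y) := by
        have hne : ENNReal.ofReal (2 * r) ^ 2 ≠ ∞ := by finiteness
        simp_rw [lintegral_const_mul' _ _ hne]
    _ = ENNReal.ofReal (2 * r) ^ 2 * ∫⁻ t in Set.Ioc (0 : ℝ) 1, ∫⁻ x in B, ∫⁻ y in B,
          G ((1 - t) • x + t • y) := by
        congr 1
        have h1 : ∀ x, ∫⁻ y in B, ∫⁻ t in Set.Ioc (0 : ℝ) 1, G ((1 - t) • x + t • y) =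
            ∫⁻ t in Set.Ioc (0 : ℝ) 1, ∫⁻ y in B, G ((1 - t) • x + t • y) := by
          intro x
          rw [lintegral_lintegral_swap]
          fun_prop
        simp_rw [h1]
        rw [lintegral_lintegral_swap]
        apply Measurable.aemeasurable
        apply Measurable.lintegral_prod_right'
          (f := fun p : (EuclideanSpace ℝ (Fin d) × ℝ) × EuclideanSpace ℝ (Fin d) =>
            G ((1 - p.1.2) • p.1.1 + p.1.2 • p.2))
        fun_prop
    _ ≤ ENNReal.ofReal (2 * r) ^ 2 * ∫⁻ t in Set.Ioc (0 : ℝ) 1, (2 ^ d * volume B) * ∫⁻ x, G x := by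
        exact mul_le_mul_right (setLIntegral_mono' measurableSet_Ioc key) _
    _ = _ := by
        rw [setLIntegral_const, hGint]; simp [mul_assoc]

lemma npb_main {d : ℕ} (x₀ : EuclideanSpace ℝ (Fin d)) (r : ℝ)
    (A : EuclideanSpace ℝ (Fin d) → ℝ≥0∞) (hA : Measurable A) (hA1 : ∀ x, A x ≤ 1)
    (w : EuclideanSpace ℝ (Fin d) → ℂ) (hw : ContDiff ℝ (⊤ : ℕ∞) w) :
    (∫⁻ y in ball x₀ r, A y) * ∫⁻ x in ball x₀ r, ‖w x‖ₑ ^ 2 ≤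
      2 * volume (ball x₀ r) * (∫⁻ y in ball x₀ r, A y * ‖w y‖ₑ ^ 2) +
      2 * (ENNReal.ofReal (2 * r) ^ 2 * (2 ^ d * volume (ball x₀ r))) *
        ∫⁻ x in ball x₀ r, ‖fderiv ℝ w x‖ₑ ^ 2 := by
  have hwc : Continuous w := hw.continuous
  set B := ball x₀ r with hB
  have hm : Measurable fun y => ‖w y‖ₑ ^ 2 := by fun_prop
  have pt : ∀ x y, A y * ‖w x‖ₑ ^ 2 ≤ 2 * (A y * ‖w y‖ₑ ^ 2) + 2 * ‖w x - w y‖ₑ ^ 2 := by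
    intro x y
    have h1 : ‖w x‖ₑ ^ 2 ≤ 2 * ‖w y‖ₑ ^ 2 + 2 * ‖w x - w y‖ₑ ^ 2 := by
      have h0 : ‖w x‖ ^ 2 ≤ 2 * ‖w y‖ ^ 2 + 2 * ‖w x - w y‖ ^ 2 := by
        have := norm_add_le (w y) (w x - w y)
        rw [add_sub_cancel] at this
        nlinarith [sq_nonneg (‖w y‖ - ‖w x - w y‖), norm_nonneg (w x), norm_nonneg (w y),
          norm_nonneg (w x - w y)]
      simp only [enorm_eq_nnnorm]
      exact_mod_cast h0
    calc A y * ‖w x‖ₑ ^ 2 ≤ A y * (2 * ‖w y‖ₑ ^ 2 + 2 * ‖w x - w y‖ₑ ^ 2) := by gcongr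
      _ = 2 * (A y * ‖w y‖ₑ ^ 2) + A y * (2 * ‖w x - w y‖ₑ ^ 2) := by ring
      _ ≤ _ := by
        gcongr _ + ?_
        exact mul_le_of_le_one_left (zero_le) (hA1 y)
  calc (∫⁻ y in B, A y) * ∫⁻ x in B, ‖w x‖ₑ ^ 2
      = ∫⁻ x in B, ∫⁻ y in B, A y * ‖w x‖ₑ ^ 2 := by
        rw [← lintegral_const_mul _ hm]
        congr 1; ext x
        rw [lintegral_mul_const _ hA]
    _ ≤ ∫⁻ x in B, ∫⁻ y in B, (2 * (A y * ‖w y‖ₑ ^ 2) + 2 * ‖w x - w y‖ₑ ^ 2) := by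
        gcongr with x y
        exact pt x y
    _ = ∫⁻ x in B, (2 * (∫⁻ y in B, A y * ‖w y‖ₑ ^ 2) + 2 * ∫⁻ y in B, ‖w x - w y‖ₑ ^ 2) := by
        congr 1; ext x
        rw [lintegral_add_left (by fun_prop), lintegral_const_mul _ (by fun_prop),
          lintegral_const_mul _ (by fun_prop)]
    _ = 2 * volume B * (∫⁻ y in B, A y * ‖w y‖ₑ ^ 2) +
          2 * ∫⁻ x in B, ∫⁻ y in B, ‖w x - w y‖ₑ ^ 2 := by
        rw [lintegral_add_left (by fun_prop), setLIntegral_const, lintegral_const_mul' _ _ (by simp)]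
        ring
    _ ≤ _ := by
        rw [mul_assoc 2 (_ * _)]
        gcongr _ + 2 * ?_
        exact npb_double x₀ r w hw

/-- **Neumann-form perturbation estimate (eq. hb.lbound.2) in the proof of Lemma 3.5,
for a ball:** if `a ≥ 0` a.e. on the ball `B`, `a` is integrable on `B` and
`∫_B a > 0`, then `‖∇w‖²_{L²(B)} + b‖a^{1/2}w‖²_{L²(B)} ≳ b‖w‖²_{L²(B)}` for small `b > 0`. -/
theorem neumann_perturbation_lower_bound_ball
    (d : ℕ) (hd : 1 ≤ d)
    (x₀ : EuclideanSpace ℝ (Fin d)) (r₀ : ℝ) (hr₀ : 0 < r₀)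
    (a : EuclideanSpace ℝ (Fin d) → ℝ)
    (ha_meas : Measurable a)
    (ha_nonneg : ∀ᵐ x, x ∈ ball x₀ r₀ → 0 ≤ a x)
    (ha_int : IntegrableOn a (ball x₀ r₀))
    (ha_pos : 0 < ∫ x in ball x₀ r₀, a x) :
    ∃ b₀ c : ℝ, 0 < b₀ ∧ 0 < c ∧
      ∀ b : ℝ, b ∈ Set.Ioc (0 : ℝ) b₀ →
      ∀ w : EuclideanSpace ℝ (Fin d) → ℂ, ContDiff ℝ (⊤ : ℕ∞) w →
        c * b * ∫ x in ball x₀ r₀, ‖w x‖ ^ 2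
          ≤ (∫ x in ball x₀ r₀, ‖fderiv ℝ w x‖ ^ 2)
            + b * ∫ x in ball x₀ r₀, a x * ‖w x‖ ^ 2 := by
  set B := ball x₀ r₀ with hB
  have hBm : MeasurableSet B := measurableSet_ball
  have hBfin : volume B ≠ ∞ := measure_ball_lt_top.ne
  have hann : 0 ≤ᵐ[volume.restrict B] a := by
    rw [Filter.EventuallyLE, ae_restrict_iff' hBm]; exact ha_nonneg
  set A : EuclideanSpace ℝ (Fin d) → ℝ≥0∞ := fun x => min (ENNReal.ofReal (a x)) 1 with hAdef
  have hA : Measurable A := by fun_prop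
  have hA1 : ∀ x, A x ≤ 1 := fun x => min_le_right _ _
  set α := ∫⁻ y in B, A y with hα
  have hα0 : α ≠ 0 := by
    intro h
    rw [hα, lintegral_eq_zero_iff hA] at h
    have : ∫ x in B, a x ≤ 0 := by
      apply integral_nonpos_of_ae
      filter_upwards [h] with x hx
      have h2 : min (ENNReal.ofReal (a x)) 1 = 0 := hx
      rcases min_eq_iff.1 h2 with h3 | h3
      · exact ENNReal.ofReal_eq_zero.1 h3.1
      · exact absurd h3.1 one_ne_zero
    linarith
  have hαfin : α ≠ ∞ := by
    have : α ≤ ∫⁻ y in B, 1 := lintegral_mono hA1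
    rw [setLIntegral_const, one_mul] at this
    exact ne_top_of_le_ne_top hBfin this
  set K₁ := 2 * volume B with hK₁
  set K₂ := 2 * (ENNReal.ofReal (2 * r₀) ^ 2 * (2 ^ d * volume B)) with hK₂
  have hK₁fin : K₁ ≠ ∞ := by finiteness
  have hK₂fin : K₂ ≠ ∞ := by finiteness
  have hαp : 0 < α.toReal := ENNReal.toReal_pos hα0 hαfin
  set K := K₁.toReal + K₂.toReal + 1 with hK
  have hKp : 0 < K := by positivity
  refine ⟨1, α.toReal / K, one_pos, by positivity, ?_⟩
  rintro b ⟨hb0, hb1⟩ w hw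
  have hwc : Continuous w := hw.continuous
  have hc : Continuous (fderiv ℝ w) := hw.continuous_fderiv (by simp)
  have main := npb_main x₀ r₀ A hA hA1 w hw
  have cint : ∀ f : EuclideanSpace ℝ (Fin d) → ℝ, Continuous f → IntegrableOn f B := fun f hf =>
    (hf.continuousOn.integrableOn_compact (isCompact_closedBall x₀ r₀)).mono_set ball_subset_closedBall
  have eW : ENNReal.ofReal (∫ x in B, ‖w x‖ ^ 2) = ∫⁻ x in B, ‖w x‖ₑ ^ 2 := by
    rw [ofReal_integral_eq_lintegral_ofReal (cint _ (by fun_prop)) (ae_of_all _ fun x => by positivity)]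
    simp_rw [ENNReal.ofReal_pow (norm_nonneg _), ofReal_norm]
  have eD : ENNReal.ofReal (∫ x in B, ‖fderiv ℝ w x‖ ^ 2) = ∫⁻ x in B, ‖fderiv ℝ w x‖ₑ ^ 2 := by
    rw [ofReal_integral_eq_lintegral_ofReal (cint _ (by fun_prop)) (ae_of_all _ fun x => by positivity)]
    simp_rw [ENNReal.ofReal_pow (norm_nonneg _), ofReal_norm]
  have haw : IntegrableOn (fun x => a x * ‖w x‖ ^ 2) B := by
    obtain ⟨C, hC⟩ := (isCompact_closedBall x₀ r₀).exists_bound_of_continuousOn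
      (f := fun x => ‖w x‖ ^ 2) (by fun_prop)
    refine Integrable.mul_bdd (c := C) ha_int (by fun_prop) ?_
    rw [ae_restrict_iff' hBm]
    exact ae_of_all _ fun x hx => hC x (ball_subset_closedBall hx)
  have eA : ∫⁻ x in B, A x * ‖w x‖ₑ ^ 2 ≤ ENNReal.ofReal (∫ x in B, a x * ‖w x‖ ^ 2) := by
    rw [ofReal_integral_eq_lintegral_ofReal haw
      (by filter_upwards [hann] with x hx using mul_nonneg hx (by positivity))]
    gcongr with x
    rw [ENNReal.ofReal_mul' (by positivity), ENNReal.ofReal_pow (norm_nonneg _), ofReal_norm]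
    gcongr
    exact min_le_left _ _
  set W := ∫ x in B, ‖w x‖ ^ 2
  set D := ∫ x in B, ‖fderiv ℝ w x‖ ^ 2
  set Q := ∫ x in B, a x * ‖w x‖ ^ 2
  have hW : 0 ≤ W := integral_nonneg fun x => by positivity
  have hD : 0 ≤ D := integral_nonneg fun x => by positivity
  have hQ : 0 ≤ Q := integral_nonneg_of_ae
    (by filter_upwards [hann] with x hx using mul_nonneg hx (by positivity))
  have fin : α * ENNReal.ofReal W ≤ K₁ * ENNReal.ofReal Q + K₂ * ENNReal.ofReal D := by
    rw [eW, eD]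
    exact main.trans (by gcongr)
  have finR : α.toReal * W ≤ K₁.toReal * Q + K₂.toReal * D := by
    have := ENNReal.toReal_mono (by finiteness) fin
    rwa [ENNReal.toReal_add (by finiteness) (by finiteness), ENNReal.toReal_mul (a := α),
      ENNReal.toReal_mul (a := K₁), ENNReal.toReal_mul (a := K₂), ENNReal.toReal_ofReal hW, ENNReal.toReal_ofReal hQ,
      ENNReal.toReal_ofReal hD] at this
  have h1 : 0 ≤ K₁.toReal := ENNReal.toReal_nonneg
  have h2 : 0 ≤ K₂.toReal := ENNReal.toReal_nonneg
  have hle1 : K₁.toReal * (b * Q) ≤ K * (b * Q) := by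
    gcongr; rw [hK]; linarith
  have hle2 : K₂.toReal * D * b ≤ K * D := by
    calc K₂.toReal * D * b ≤ K₂.toReal * D * 1 := by gcongr
      _ ≤ K * D := by rw [mul_one]; gcongr; rw [hK]; linarith
  rw [div_mul_eq_mul_div, div_mul_eq_mul_div, div_le_iff₀ hKp]
  nlinarith [mul_le_mul_of_nonneg_right finR hb0.le]
end
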